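/- arXiv:1906.03898 — 7 statements merged into one kernel-verified Lean document; each statement's English description precedes it below -/
import Mathlib

section
/- For all integers i, j ≥ 0 with i + j ≥ 1 and all (n,m) ∈ ℤ², the polynomials Q satisfy the alternative recursion Q_{(i,j)}(n,m) = u(n,m)·(Q_{(i−1,j)}(n+1,m) + Q_{(i,j−1)}(n,m+1)), where any term Q with a negative index is taken to be 0. -/
/-- The lattice-path polynomials `Q_{(i,j)}` built from `u : ℤ × ℤ → R`. -/
noncomputable def Qp {R : Type*} [CommRing R] (u : ℤ → ℤ → R) : ℕ → ℕ → ℤ → ℤ → R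
  | 0, 0, n, m => u n m
  | i+1, 0, n, m => Qp u i 0 n m * u (n + (i+1 : ℕ)) m
  | 0, j+1, n, m => Qp u 0 j n m * u n (m + (j+1 : ℕ))
  | i+1, j+1, n, m => (Qp u (i+1) j n m + Qp u i (j+1) n m) * u (n + (i+1 : ℕ)) (m + (j+1 : ℕ))

/-- Extension of `Qp` to integer indices, with `Q` vanishing whenever an index is negative. -/
noncomputable def Qe {R : Type*} [CommRing R] (u : ℤ → ℤ → R) (i j : ℤ) (n m : ℤ) : R :=
  if 0 ≤ i ∧ 0 ≤ j then Qp u i.toNat j.toNat n m else 0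

theorem Qp_succ_zero {R : Type*} [CommRing R] (u : ℤ → ℤ → R) (i : ℕ) (n m : ℤ) :
    Qp u (i + 1) 0 n m = u n m * Qp u i 0 (n + 1) m := by
  induction i with
  | zero => simp [Qp]
  | succ i ih =>
    have h : n + ((i + 1 + 1 : ℕ) : ℤ) = n + 1 + ((i + 1 : ℕ) : ℤ) := by push_cast; ring
    rw [Qp, ih, Qp.eq_2 u (n + 1), h, mul_assoc]

theorem Qp_zero_succ {R : Type*} [CommRing R] (u : ℤ → ℤ → R) (j : ℕ) (n m : ℤ) :
    Qp u 0 (j + 1) n m = u n m * Qp u 0 j n (m + 1) := by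
  induction j with
  | zero => simp [Qp]
  | succ j ih =>
    have h : m + ((j + 1 + 1 : ℕ) : ℤ) = m + 1 + ((j + 1 : ℕ) : ℤ) := by push_cast; ring
    rw [Qp, ih, Qp.eq_3 u n (m + 1), h, mul_assoc]

theorem Qp_succ_succ {R : Type*} [CommRing R] (u : ℤ → ℤ → R) (i j : ℕ) (n m : ℤ) :
    Qp u (i + 1) (j + 1) n m =
      u n m * (Qp u i (j + 1) (n + 1) m + Qp u (i + 1) j n (m + 1)) := by
  have shift (a : ℤ) (k : ℕ) : a + ((k + 1 + 1 : ℕ) : ℤ) = a + 1 + ((k + 1 : ℕ) : ℤ) := by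
    push_cast; ring
  have shift_one (a : ℤ) : a + ((0 + 1 : ℕ) : ℤ) = a + 1 := by simp
  have step_row (i : ℕ) (n m : ℤ) :
      Qp u (i + 1) 0 n m = Qp u i 0 n m * u (n + (i + 1 : ℕ)) m := by rw [Qp]
  have step_col (j : ℕ) (n m : ℤ) :
      Qp u 0 (j + 1) n m = Qp u 0 j n m * u n (m + (j + 1 : ℕ)) := by rw [Qp]
  have step (i j : ℕ) (n m : ℤ) : Qp u (i + 1) (j + 1) n m =
      (Qp u (i + 1) j n m + Qp u i (j + 1) n m) * u (n + (i + 1 : ℕ)) (m + (j + 1 : ℕ)) := by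
    rw [Qp]
  induction i generalizing j with
  | zero =>
    induction j with
    | zero =>
      rw [step, Qp_succ_zero, Qp_zero_succ, step_row, step_col, shift_one, shift_one]
      ring
    | succ j ih =>
      rw [step 0 (j + 1) n m, ih, Qp_zero_succ u (j + 1) n m, step 0 j n (m + 1),
        step_col (j + 1) (n + 1) m, shift_one, shift]
      ring
  | succ i ihi =>
    induction j with
    | zero =>
      rw [step (i + 1) 0 n m, ihi, Qp_succ_zero u (i + 1) n m, step i 0 (n + 1) m,
        step_row (i + 1) n (m + 1), shift_one, shift]
      ring
    | succ j ih =>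
      rw [step (i + 1) (j + 1) n m, ih, ihi, step i (j + 1) (n + 1) m,
        step (i + 1) j n (m + 1), shift, shift]
      ring

/-- the alternative recursion
`Q_{(i,j)}(n,m) = u(n,m) · (Q_{(i-1,j)}(n+1,m) + Q_{(i,j-1)}(n,m+1))`. -/
theorem Q_alternative_recursion {R : Type*} [CommRing R] (u : ℤ → ℤ → R)
    (i j : ℤ) (hi : 0 ≤ i) (hj : 0 ≤ j) (hij : 1 ≤ i + j) (n m : ℤ) :
    Qe u i j n m = u n m * (Qe u (i - 1) j (n + 1) m + Qe u i (j - 1) n (m + 1)) := by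
  lift i to ℕ using hi
  lift j to ℕ using hj
  rcases i with _ | i <;> rcases j with _ | j
  · simp at hij
  · simpa [Qe, show (0 : ℤ) ≤ j + 1 by omega] using Qp_zero_succ u j n m
  · simpa [Qe, show (0 : ℤ) ≤ i + 1 by omega] using Qp_succ_zero u i n m
  · simpa [Qe, show (0 : ℤ) ≤ i + 1 by omega, show (0 : ℤ) ≤ j + 1 by omega]
      using Qp_succ_succ u i j n m
end

section
/- Let α ∈ ℝ with α ≠ 0 and u : ℤ × ℤ → ℝ satisfy, for all (n,m) ∈ ℤ²: u(n,m)·(u(n+1,m)·u(n+1,m+1) + u(n,m+1)·u(n,m+2))·u(n+1,m+2) = α and u(n,m)·(u(n+1,m)·u(n+2,m) + u(n,m+1)·u(n+1,m+1))·u(n+2,m+1) = −α. Then for every (n,m) with u(n+1,m+1)² − u(n+2,m)·u(n,m+2) ≠ 0 one has u(n+2,m+2) = (u(n,m)/(u(n+1,m)·u(n,m+1))) · (u(n+1,m)·u(n+2,m) + u(n,m+1)·u(n+1,m+1)) · (u(n,m+1)·u(n,m+2) + u(n+1,m)·u(n+1,m+1)) / (u(n+1,m+1)² − u(n+2,m)·u(n,m+2)).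 In particular the two equations are consistent: shifting either equation and eliminating u(n+1,m+2), u(n+2,m+1) yields this same value of u(n+2,m+2). -/
/-- consistency of the order-two system
`u_{0,0}(u_{1,0}u_{1,1} + u_{0,1}u_{0,2})u_{1,2} = α`,
`u_{0,0}(u_{1,0}u_{2,0} + u_{0,1}u_{1,1})u_{2,1} = -α`:
both ways of computing `u_{2,2}` give the stated value. -/
theorem consistency_example_system (α : ℝ) (hα : α ≠ 0) (u : ℤ → ℤ → ℝ)
    (h1 : ∀ n m : ℤ,
      u n m * (u (n+1) m * u (n+1) (m+1) + u n (m+1) * u n (m+2)) * u (n+1) (m+2) = α)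
    (h2 : ∀ n m : ℤ,
      u n m * (u (n+1) m * u (n+2) m + u n (m+1) * u (n+1) (m+1)) * u (n+2) (m+1) = -α) :
    ∀ n m : ℤ, u (n+1) (m+1) ^ 2 - u (n+2) m * u n (m+2) ≠ 0 →
      u (n+2) (m+2) =
        u n m / (u (n+1) m * u n (m+1)) *
          (u (n+1) m * u (n+2) m + u n (m+1) * u (n+1) (m+1)) *
          (u n (m+1) * u n (m+2) + u (n+1) m * u (n+1) (m+1)) /
          (u (n+1) (m+1) ^ 2 - u (n+2) m * u n (m+2)) := by
  intro n m hD
  have e1 := h1 n m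
  have e2 := h2 n m
  have e3 := h1 (n + 1) m
  have e4 := h2 n (m + 1)
  simp only [add_assoc, show (1 : ℤ) + 1 = 2 from rfl] at e3 e4
  have hb : u (n+1) m ≠ 0 := by
    intro h
    apply hα
    rw [← e3, h]
    ring
  have hc : u n (m+1) ≠ 0 := by
    intro h
    apply hα
    rw [← neg_eq_zero, ← e4, h]
    ring
  have key : u (n+2) (m+2) * (u (n+1) m * u n (m+1) *
        (u (n+1) (m+1) ^ 2 - u (n+2) m * u n (m+2))) =
      u n m * (u (n+1) m * u (n+2) m + u n (m+1) * u (n+1) (m+1)) *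
        (u n (m+1) * u n (m+2) + u (n+1) m * u (n+1) (m+1)) := by
    apply mul_left_cancel₀ hα
    linear_combination
      u n m * (u (n+1) m * u (n+1) (m+1) + u n (m+1) * u n (m+2)) *
          (u (n+1) m * u (n+2) m + u n (m+1) * u (n+1) (m+1)) * e3
        - u (n+1) m * u (n+2) (m+2) * u (n+1) (m+1) *
          (u (n+1) m * u (n+2) m + u n (m+1) * u (n+1) (m+1)) * e1
        - u (n+1) m * u (n+2) (m+2) * u (n+2) m *
          (u (n+1) m * u (n+1) (m+1) + u n (m+1) * u n (m+2)) * e2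
  rw [div_mul_eq_mul_div, div_mul_eq_mul_div, div_div]
  exact eq_div_of_mul_eq (mul_ne_zero (mul_ne_zero hb hc) hD) key
end

section
/- Let p, q ∈ ℝ with p ≠ q, and let τ : ℤ × ℤ → ℝ be nowhere zero and satisfy, for all (n,m) ∈ ℤ²: (p+q)·τ(n,m+2)·τ(n+1,m) − (p−q)·τ(n,m)·τ(n+1,m+2) − 2q·τ(n,m+1)·τ(n+1,m+1) = 0 and (p+q)·τ(n+2,m)·τ(n,m+1) − (q−p)·τ(n,m)·τ(n+2,m+1) − 2p·τ(n+1,m)·τ(n+1,m+1) = 0. Then the consistency of this system yields the discrete Toda equation: for all (n,m), (p−q)²·τ(n,m)·τ(n+2,m+2) = (p+q)²·τ(n+2,m)·τ(n,m+2) − 4pq·τ(n+1,m+1)². -/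
/-- the consistency of the bilinear system for the τ-function of the lattice
KdV yields the discrete Toda equation
`(p-q)² τ_{0,0} τ_{2,2} = (p+q)² τ_{2,0} τ_{0,2} - 4pq τ_{1,1}²`. -/
theorem tau_system_gives_discrete_Toda (p q : ℝ) (hpq : p ≠ q) (τ : ℤ → ℤ → ℝ)
    (hτ : ∀ n m : ℤ, τ n m ≠ 0)
    (h1 : ∀ n m : ℤ,
      (p + q) * τ n (m+2) * τ (n+1) m - (p - q) * τ n m * τ (n+1) (m+2)
        - 2 * q * τ n (m+1) * τ (n+1) (m+1) = 0)
    (h2 : ∀ n m : ℤ,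
      (p + q) * τ (n+2) m * τ n (m+1) - (q - p) * τ n m * τ (n+2) (m+1)
        - 2 * p * τ (n+1) m * τ (n+1) (m+1) = 0) :
    ∀ n m : ℤ,
      (p - q) ^ 2 * τ n m * τ (n+2) (m+2) =
        (p + q) ^ 2 * τ (n+2) m * τ n (m+2) - 4 * p * q * τ (n+1) (m+1) ^ 2 := by
  intro n m
  have h := h1 (n + 1) m
  rw [show n + 1 + 1 = n + 2 by ring] at h
  apply mul_left_cancel₀ (hτ (n + 1) m)
  linear_combination -(p - q) * τ n m * h - (p + q) * τ (n + 2) m * h1 n m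
    - 2 * q * τ (n + 1) (m + 1) * h2 n m
end

section
/- (Conservation law of the quad equation.) Let v : ℤ × ℤ → ℝ satisfy v(n+1,m)·v(n,m+1)·(v(n,m) + v(n+1,m+1)) + 1 = 0 for all (n,m) ∈ ℤ². Then for all (n,m): v(n,m+1)·(v(n+2,m)·v(n+1,m)·v(n,m) − 1) = v(n+2,m)·(v(n+2,m+1)·v(n+1,m+1)·v(n,m+1) − 1). (This is the cross-multiplied form of the conservation law (T−1)ln(v_{0,0}/(v_{2,0}v_{1,0}v_{0,0}−1)) = (S−1)ln(v_{0,0}v_{1,0}), using that all values of v are nonzero on solutions.) -/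
/-- conservation law of the quad equation
`v_{1,0} v_{0,1} (v_{0,0} + v_{1,1}) + 1 = 0`, in cross-multiplied form. -/
theorem conservation_law_quad (v : ℤ → ℤ → ℝ)
    (h : ∀ n m : ℤ, v (n+1) m * v n (m+1) * (v n m + v (n+1) (m+1)) + 1 = 0) :
    ∀ n m : ℤ,
      v n (m+1) * (v (n+2) m * v (n+1) m * v n m - 1) =
        v (n+2) m * (v (n+2) (m+1) * v (n+1) (m+1) * v n (m+1) - 1) := by
  intro n m
  have h' := h (n + 1) m
  rw [show n + 1 + 1 = n + 2 by ring] at h'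
  linear_combination v (n + 2) m * h n m - v n (m + 1) * h'
end

section
/- (Potentiation.) Let v : ℤ × ℤ → ℝ satisfy the quad equation v(n+1,m)·v(n,m+1)·(v(n,m) + v(n+1,m+1)) + 1 = 0 for all (n,m), and let u : ℤ × ℤ → ℝ be nowhere zero and satisfy, for all (n,m): v(n+2,m)·v(n+1,m)·v(n,m) ≠ 1, u(n+1,m)·(v(n+2,m)·v(n+1,m)·v(n,m) − 1) = u(n,m)·v(n,m), and u(n,m+1) = u(n,m)·v(n,m)·v(n+1,m). Then: (i) v(n,m)·(u(n+1,m+1) − u(n,m)) = u(n+1,m) for all (n,m); and (ii) u satisfies the consistent system: (u(n+1,m)−u(n,m+2))·(u(n,m)−u(n+1,m+1))·u(n,m+1) − (u(n+1,m)−u(n,m+2))·u(n,m)·u(n+1,m+2) − u(n,m+2)·u(n+1,m+1)·u(n+1,m+2) = 0 and (u(n+1,m)−u(n+2,m+1))·(u(n,m)−u(n+1,m+1))·u(n,m+1) − u(n,m)·u(n+1,m)·u(n+2,m) = 0, for all (n,m). -/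
/-- potentiation of the quad equation
`v_{1,0} v_{0,1} (v_{0,0} + v_{1,1}) + 1 = 0`.  The potential `u` defined by
`u_{1,0}/u_{0,0} = v_{0,0}/(v_{2,0}v_{1,0}v_{0,0} - 1)` and `u_{0,1}/u_{0,0} = v_{0,0}v_{1,0}`
satisfies `v_{0,0}(u_{1,1} - u_{0,0}) = u_{1,0}` and the consistent order-two system. -/
theorem potentiation (v u : ℤ → ℤ → ℝ)
    (hquad : ∀ n m : ℤ, v (n+1) m * v n (m+1) * (v n m + v (n+1) (m+1)) + 1 = 0)
    (hu : ∀ n m : ℤ, u n m ≠ 0)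
    (hden : ∀ n m : ℤ, v (n+2) m * v (n+1) m * v n m ≠ 1)
    (hpot1 : ∀ n m : ℤ,
      u (n+1) m * (v (n+2) m * v (n+1) m * v n m - 1) = u n m * v n m)
    (hpot2 : ∀ n m : ℤ, u n (m+1) = u n m * v n m * v (n+1) m) :
    (∀ n m : ℤ, v n m * (u (n+1) (m+1) - u n m) = u (n+1) m) ∧
    (∀ n m : ℤ,
      (u (n+1) m - u n (m+2)) * (u n m - u (n+1) (m+1)) * u n (m+1)
        - (u (n+1) m - u n (m+2)) * u n m * u (n+1) (m+2)
        - u n (m+2) * u (n+1) (m+1) * u (n+1) (m+2) = 0) ∧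
    (∀ n m : ℤ,
      (u (n+1) m - u (n+2) (m+1)) * (u n m - u (n+1) (m+1)) * u n (m+1)
        - u n m * u (n+1) m * u (n+2) m = 0) := by
  have hi (n m : ℤ) : v n m * (u (n+1) (m+1) - u n m) = u (n+1) m := by
    have h := hpot2 (n+1) m
    rw [show n + 1 + 1 = n + 2 by ring] at h
    linear_combination v n m * h + hpot1 n m
  refine ⟨hi, fun n m => ?_, fun n m => ?_⟩
  · have hX := hi n m
    have hY := hi n (m+1)
    have h01 := hpot2 n m
    have h02 := hpot2 n (m+1)
    have hq := hquad n m
    rw [show m + 1 + 1 = m + 2 by ring] at hY h02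
    have h02' : u n (m+2) = -(u n m * v n m * (1 + v n m * v (n+1) m * v n (m+1))) := by
      rw [h02, h01]
      linear_combination u n m * v n m * hq
    have hdiff : u (n+1) m - u n (m+2) = v n m * v n (m+1) * u (n+1) (m+2) := by
      rw [h02']
      linear_combination -hX - v n m * hY - v n m * v n (m+1) * h01
    rw [hdiff, h02', h01]
    rw [h01] at hY
    linear_combination -(u n m * v n m * u (n+1) (m+2)) * hY
  · have hX := hi n m
    have hY := hi (n+1) m
    rw [show n + 1 + 1 = n + 2 by ring] at hY
    rw [hpot2 n m, ← hY, ← hX]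
    ring
end

section
/- Let u : ℝ → ℤ × ℤ → ℝ with u(t,n,m) ≠ 0 for all t, n, m, and suppose that for every (n,m) and every t the function t ↦ u(t,n,m) has derivative u(t,n,m)·(u(t,n+2,m)/u(t,n−1,m) + u(t,n+1,m)/u(t,n−2,m)) at t. Define E(t,n,m) = (u(t,n+1,m) − u(t,n+2,m+1))·(u(t,n,m) − u(t,n+1,m+1))·u(t,n,m+1) − u(t,n,m)·u(t,n+1,m)·u(t,n+2,m). If at some time t₀ one has E(t₀,n,m) = 0 for all (n,m) ∈ ℤ², then for every (n,m) the function t ↦ E(t,n,m) has derivative 0 at t₀. (The flow ∂_t u_{0,0} = u_{0,0}(u_{2,0}/u_{−1,0} + u_{1,0}/u_{−2,0}) is a generalized symmetry of the two-quad equation (u_{1,0}−u_{2,1})(u_{0,0}−u_{1,1})u_{0,1} − u_{0,0}u_{1,0}u_{2,0} = 0.) -/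
/-- The variable `x_k = 1 - b_{k+1} / a_k` attached to two neighbouring rows `a`, `b` of a solution
of the two-quad equation. -/
noncomputable def rowRatio (a b : ℤ → ℝ) (k : ℤ) : ℝ := 1 - b (k + 1) / a k

/-- The relation between two neighbouring rows expressed by the two-quad equation. -/
def TwoQuad (a b : ℤ → ℝ) : Prop :=
  ∀ k, (a (k + 1) - b (k + 2)) * (a k - b (k + 1)) * b k - a k * a (k + 1) * a (k + 2) = 0

/-- The logarithmic derivative of `a k` along the horizontal flow. -/
noncomputable def flowRate (a : ℤ → ℝ) (k : ℤ) : ℝ := a (k + 2) / a (k - 1) + a (k + 1) / a (k - 2)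

section rows

variable {a b : ℤ → ℝ}

theorem eq_mul_one_sub_rowRatio (ha : ∀ k, a k ≠ 0) (k : ℤ) :
    b (k + 1) = a k * (1 - rowRatio a b k) := by
  have := ha k
  simp only [rowRatio]
  field_simp
  ring

theorem TwoQuad.eq_rowRatio_mul (h : TwoQuad a b) (ha : ∀ k, a k ≠ 0) (k : ℤ) :
    a (k + 2) = rowRatio a b k * rowRatio a b (k + 1) * b k := by
  have hk := h k
  have h₁ := eq_mul_one_sub_rowRatio (b := b) ha k
  have h₂ := eq_mul_one_sub_rowRatio (b := b) ha (k + 1)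
  rw [show k + 1 + 1 = k + 2 by ring] at h₂
  rw [h₁, h₂] at hk
  refine mul_left_cancel₀ (mul_ne_zero (ha k) (ha (k + 1))) ?_
  linear_combination -hk

theorem TwoQuad.div_eq_left (h : TwoQuad a b) (ha : ∀ k, a k ≠ 0) (k : ℤ) :
    a (k + 3) / a k =
      rowRatio a b (k + 1) * rowRatio a b (k + 2) * (1 - rowRatio a b k) := by
  have h₁ := eq_mul_one_sub_rowRatio (b := b) ha k
  have h₂ := h.eq_rowRatio_mul ha (k + 1)
  rw [show k + 1 + 2 = k + 3 by ring, show k + 1 + 1 = k + 2 by ring, h₁] at h₂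
  rw [div_eq_iff (ha k), h₂]
  ring

theorem TwoQuad.div_eq_right (h : TwoQuad a b) (ha : ∀ k, a k ≠ 0) (hb : ∀ k, b k ≠ 0) (k : ℤ) :
    b (k + 3) / b k =
      rowRatio a b k * rowRatio a b (k + 1) * (1 - rowRatio a b (k + 2)) := by
  have h₁ := eq_mul_one_sub_rowRatio (b := b) ha (k + 2)
  rw [show k + 2 + 1 = k + 3 by ring, h.eq_rowRatio_mul ha k] at h₁
  rw [div_eq_iff (hb k), h₁]
  ring

theorem TwoQuad.flowRate_left (h : TwoQuad a b) (ha : ∀ k, a k ≠ 0) (k : ℤ) :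
    flowRate a k =
      rowRatio a b k * rowRatio a b (k + 1) * (1 - rowRatio a b (k - 1)) +
        rowRatio a b (k - 1) * rowRatio a b k * (1 - rowRatio a b (k - 2)) := by
  have h₁ := h.div_eq_left ha (k - 1)
  have h₂ := h.div_eq_left ha (k - 2)
  ring_nf at h₁ h₂ ⊢
  simp only [flowRate]
  ring_nf
  linear_combination h₁ + h₂

theorem TwoQuad.flowRate_right (h : TwoQuad a b) (ha : ∀ k, a k ≠ 0) (hb : ∀ k, b k ≠ 0) (k : ℤ) :
    flowRate b k =
      rowRatio a b (k - 1) * rowRatio a b k * (1 - rowRatio a b (k + 1)) +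
        rowRatio a b (k - 2) * rowRatio a b (k - 1) * (1 - rowRatio a b k) := by
  have h₁ := h.div_eq_right ha hb (k - 1)
  have h₂ := h.div_eq_right ha hb (k - 2)
  ring_nf at h₁ h₂ ⊢
  simp only [flowRate]
  ring_nf
  linear_combination h₁ + h₂

/-- The linearization of the two-quad equation vanishes along the horizontal flow. -/
theorem TwoQuad.linearization_flow_eq_zero (h : TwoQuad a b) (ha : ∀ k, a k ≠ 0)
    (hb : ∀ k, b k ≠ 0) (k : ℤ) :
    ((a (k + 1) * flowRate a (k + 1) - b (k + 2) * flowRate b (k + 2)) * (a k - b (k + 1)) +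
          (a (k + 1) - b (k + 2)) * (a k * flowRate a k - b (k + 1) * flowRate b (k + 1))) * b k +
        (a (k + 1) - b (k + 2)) * (a k - b (k + 1)) * (b k * flowRate b k) -
      ((a k * flowRate a k * a (k + 1) + a k * (a (k + 1) * flowRate a (k + 1))) * a (k + 2) +
        a k * a (k + 1) * (a (k + 2) * flowRate a (k + 2))) = 0 := by
  have h₁ := eq_mul_one_sub_rowRatio (b := b) ha k
  have h₂ := eq_mul_one_sub_rowRatio (b := b) ha (k + 1)
  rw [show k + 1 + 1 = k + 2 by ring] at h₂
  simp only [h.flowRate_left ha, h.flowRate_right ha hb]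
  rw [h.eq_rowRatio_mul ha k, h₁, h₂]
  ring_nf

end rows

/-- the flow `∂_t u_{0,0} = u_{0,0}(u_{2,0}/u_{-1,0} + u_{1,0}/u_{-2,0})`
is a generalized symmetry of the two-quad equation
`(u_{1,0}-u_{2,1})(u_{0,0}-u_{1,1})u_{0,1} - u_{0,0}u_{1,0}u_{2,0} = 0`. -/
theorem symmetry_horizontal_flow (u : ℝ → ℤ → ℤ → ℝ)
    (hu : ∀ (t : ℝ) (n m : ℤ), u t n m ≠ 0)
    (hflow : ∀ (n m : ℤ) (t : ℝ),
      HasDerivAt (fun s => u s n m)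
        (u t n m * (u t (n+2) m / u t (n-1) m + u t (n+1) m / u t (n-2) m)) t)
    (E : ℝ → ℤ → ℤ → ℝ)
    (hE : ∀ (t : ℝ) (n m : ℤ),
      E t n m = (u t (n+1) m - u t (n+2) (m+1)) * (u t n m - u t (n+1) (m+1)) * u t n (m+1)
        - u t n m * u t (n+1) m * u t (n+2) m)
    (t₀ : ℝ) (hsol : ∀ n m : ℤ, E t₀ n m = 0) :
    ∀ n m : ℤ, HasDerivAt (fun s => E s n m) 0 t₀ := by
  intro n m
  have hquad : TwoQuad (fun k => u t₀ k m) (fun k => u t₀ k (m + 1)) := fun k => by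
    simpa only [hE] using hsol k m
  have hzero := hquad.linearization_flow_eq_zero (fun k => hu t₀ k m) (fun k => hu t₀ k (m + 1)) n
  simp only [hE]
  rw [← hzero]
  exact ((((hflow (n + 1) m t₀).sub (hflow (n + 2) (m + 1) t₀)).mul
    ((hflow n m t₀).sub (hflow (n + 1) (m + 1) t₀))).mul (hflow n (m + 1) t₀)).sub
    (((hflow n m t₀).mul (hflow (n + 1) m t₀)).mul (hflow (n + 2) m t₀))
end

section
/- Let a ∈ ℝ and u : ℝ → ℤ × ℤ → ℝ, and suppose that for every (n,m) and every t the function t ↦ u(t,n,m) has derivative u(t,n,m)·(1 + a·u(t,n,m))·(u(t,n,m+3)·u(t,n,m+2)·u(t,n,m+1) − u(t,n,m−1)·u(t,n,m−2)·u(t,n,m−3)) at t. Define E(t,n,m) = u(t,n,m+1)·u(t,n,m+2)·(1 + a·(u(t,n,m) + u(t,n+1,m))) + u(t,n+1,m)·u(t,n,m+2)·(1 + a·u(t,n+1,m+1)) + u(t,n+1,m)·u(t,n+1,m+1)·(1 + a·u(t,n+1,m+2)). If at some time t₀ one has E(t₀,n,m) = 0 for all (n,m) ∈ ℤ², then for every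 (n,m) the function t ↦ E(t,n,m) has derivative 0 at t₀. (The third-order flow ∂_s u_{0,0} = u_{0,0}(1 + a u_{0,0})(u_{0,3}u_{0,2}u_{0,1} − u_{0,−1}u_{0,−2}u_{0,−3}) is a generalized symmetry of the two-quad equation u_{0,1}u_{0,2}(1 + a(u_{0,0}+u_{1,0})) + u_{1,0}u_{0,2}(1 + a u_{1,1}) + u_{1,0}u_{1,1}(1 + a u_{1,2}) = 0.) -/
/-- The forward half `u_{0,0}(1 + a u_{0,0})u_{0,1}u_{0,2}u_{0,3}` of the flow changes the two-quad
equation by `a x₀x₁x₂y₀y₁y₂` on solutions. This value is fixed by the reflection `x_j ↔ y_{2-j}`,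
which also preserves the equation and exchanges the two halves of the flow. -/
theorem forward_flow_two_quad {R : Type*} [CommRing R]
    (a x0 x1 x2 x3 x4 x5 y0 y1 y2 y3 y4 y5 : R)
    (h0 : x1 * x2 * (1 + a * (x0 + y0)) + y0 * x2 * (1 + a * y1) + y0 * y1 * (1 + a * y2) = 0)
    (h1 : x2 * x3 * (1 + a * (x1 + y1)) + y1 * x3 * (1 + a * y2) + y1 * y2 * (1 + a * y3) = 0)
    (h2 : x3 * x4 * (1 + a * (x2 + y2)) + y2 * x4 * (1 + a * y3) + y2 * y3 * (1 + a * y4) = 0)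
    (h3 : x4 * x5 * (1 + a * (x3 + y3)) + y3 * x5 * (1 + a * y4) + y3 * y4 * (1 + a * y5) = 0) :
    a * x1 * x2 * (x0 * (1 + a * x0) * (x3 * x2 * x1))
      + x2 * (1 + a * (x0 + y0)) * (x1 * (1 + a * x1) * (x4 * x3 * x2))
      + (x1 * (1 + a * (x0 + y0)) + y0 * (1 + a * y1)) * (x2 * (1 + a * x2) * (x5 * x4 * x3))
      + (a * x1 * x2 + x2 * (1 + a * y1) + y1 * (1 + a * y2))
        * (y0 * (1 + a * y0) * (y3 * y2 * y1))
      + (a * y0 * x2 + y0 * (1 + a * y2)) * (y1 * (1 + a * y1) * (y4 * y3 * y2))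
      + a * y0 * y1 * (y2 * (1 + a * y2) * (y5 * y4 * y3))
      = a * x0 * x1 * x2 * y0 * y1 * y2 := by
  linear_combination
    (a * y2 * y3 * y4 * y5 - a * x2 * y3 * y4 * y5 - a * x2 * x5 * y3 * y4 - a * x2 * x4 *
      x5 * y3 - a * x2 * x3 * x4 * x5 - x2 * x4 * x5 - x2 * x5 * y3 + a * y1 * y2 * y3 * y4
      + y2 * y3 * y4 - x2 * y3 * y4 + a * y0 * y1 * y2 * y3 + a * x0 * x1 * x2 * x3 + y1 *
      y2 * y3) * h0 +
    (a * x0 * x1 * x2 * x4 + a * x1 * x2 * x4 * y0 + x1 * x2 * x4 - a * x0 * x1 * x2 * y0) *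
      h1 +
    (a * x1 * x2 * x5 * y0 + a * x0 * x1 * x2 * x5 + a * x2 * x5 * y0 * y1 + x1 * x2 * x5 +
      x2 * x5 * y0 - a * x0 * x1 * x2 * y1 - a * x1 * x2 * y0 * y1 - x1 * x2 * y1) * h2 +
    (a * x2 * x2 * y0 * y1 + a * x1 * x2 * x2 * y0 + a * x0 * x1 * x2 * x2 - a * x0 * x1 *
      x2 * y2 - a * x1 * x2 * y0 * y2 + x1 * x2 * x2 + x2 * x2 * y0 + x2 * y0 * y1 - x1 * x2
      * y2 - x2 * y0 * y2) * h3

/-- the third-order flow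
`∂_s u_{0,0} = u_{0,0}(1 + a u_{0,0})(u_{0,3}u_{0,2}u_{0,1} - u_{0,-1}u_{0,-2}u_{0,-3})`
is a generalized symmetry of the two-quad equation
`u_{0,1}u_{0,2}(1 + a(u_{0,0}+u_{1,0})) + u_{1,0}u_{0,2}(1 + a u_{1,1})
  + u_{1,0}u_{1,1}(1 + a u_{1,2}) = 0`. -/
theorem symmetry_third_order_flow (a : ℝ) (u : ℝ → ℤ → ℤ → ℝ)
    (hflow : ∀ (n m : ℤ) (t : ℝ),
      HasDerivAt (fun s => u s n m)
        (u t n m * (1 + a * u t n m) *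
          (u t n (m+3) * u t n (m+2) * u t n (m+1)
            - u t n (m-1) * u t n (m-2) * u t n (m-3))) t)
    (E : ℝ → ℤ → ℤ → ℝ)
    (hE : ∀ (t : ℝ) (n m : ℤ),
      E t n m = u t n (m+1) * u t n (m+2) * (1 + a * (u t n m + u t (n+1) m))
        + u t (n+1) m * u t n (m+2) * (1 + a * u t (n+1) (m+1))
        + u t (n+1) m * u t (n+1) (m+1) * (1 + a * u t (n+1) (m+2)))
    (t₀ : ℝ) (hsol : ∀ n m : ℤ, E t₀ n m = 0) :
    ∀ n m : ℤ, HasDerivAt (fun s => E s n m) 0 t₀ := by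
  intro n m
  obtain ⟨x, hx⟩ : ∃ x : ℤ → ℝ, ∀ k, x k = u t₀ n (m + k) := ⟨_, fun _ => rfl⟩
  obtain ⟨y, hy⟩ : ∃ y : ℤ → ℝ, ∀ k, y k = u t₀ (n+1) (m + k) := ⟨_, fun _ => rfl⟩
  have quad : ∀ k : ℤ, x (k+1) * x (k+2) * (1 + a * (x k + y k))
      + y k * x (k+2) * (1 + a * y (k+1)) + y k * y (k+1) * (1 + a * y (k+2)) = 0 := by
    intro k
    have h := hsol n (m + k)
    rw [hE] at h
    simpa only [hx, hy, add_assoc] using h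
  have dx : ∀ k : ℤ, HasDerivAt (fun s => u s n (m + k))
      (x k * (1 + a * x k) * (x (k+3) * x (k+2) * x (k+1) - x (k-1) * x (k-2) * x (k-3))) t₀ := by
    intro k
    simpa only [hx, add_assoc, add_sub_assoc] using hflow n (m + k) t₀
  have dy : ∀ k : ℤ, HasDerivAt (fun s => u s (n+1) (m + k))
      (y k * (1 + a * y k) * (y (k+3) * y (k+2) * y (k+1) - y (k-1) * y (k-2) * y (k-3))) t₀ := by
    intro k
    simpa only [hy, add_assoc, add_sub_assoc] using hflow (n+1) (m + k) t₀
  have forward := forward_flow_two_quad a (x 0) (x 1) (x 2) (x 3) (x 4) (x 5)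
    (y 0) (y 1) (y 2) (y 3) (y 4) (y 5) (quad 0) (quad 1) (quad 2) (quad 3)
  have reflected : ∀ k : ℤ, y (k+1) * y k * (1 + a * (y (k+2) + x (k+2)))
      + x (k+2) * y k * (1 + a * x (k+1)) + x (k+2) * x (k+1) * (1 + a * x k) = 0 :=
    fun k => by linear_combination quad k
  have backward := forward_flow_two_quad a (y 2) (y 1) (y 0) (y (-1)) (y (-2)) (y (-3))
    (x 2) (x 1) (x 0) (x (-1)) (x (-2)) (x (-3))
    (reflected 0) (by simpa only [Int.reduceNeg, Int.reduceAdd] using reflected (-1))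
    (by simpa only [Int.reduceNeg, Int.reduceAdd] using reflected (-2))
    (by simpa only [Int.reduceNeg, Int.reduceAdd] using reflected (-3))
  have dx0 := dx 0
  have dy0 := dy 0
  rw [add_zero] at dx0 dy0
  have deriv_E := (((dx 1).mul (dx 2)).mul (((dx0.add dy0).const_mul a).const_add 1)).add
    ((dy0.mul (dx 2)).mul (((dy 1).const_mul a).const_add 1)) |>.add
    ((dy0.mul (dy 1)).mul (((dy 2).const_mul a).const_add 1))
  rw [show (fun s => E s n m) = _ from funext fun s => hE s n m]
  refine deriv_E.congr_deriv ?_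
  have hx0 : u t₀ n m = x 0 := by rw [hx, add_zero]
  have hy0 : u t₀ (n+1) m = y 0 := by rw [hy, add_zero]
  simp only [Pi.mul_apply, Pi.add_apply, ← hx, ← hy, hx0, hy0, Int.reduceAdd, Int.reduceSub,
    Int.reduceNeg]
  linear_combination forward - backward
end
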